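/- Let d ≥ 1 and let δ ≥ d·log(2+√3). Then the sum over all nonzero lattice points β ∈ ℤ^d of e^{−δ‖β‖}, where ‖β‖ is the Euclidean norm, satisfies ∑_{β ∈ ℤ^d, β ≠ 0} e^{−δ‖β‖} ≤ 1 − (2+√3)^{−d}; in particular this sum is strictly less than 1. -/

import Mathlib

open scoped BigOperators

/-- The sum of a product function over `ℤᵈ` with equal factors is the `d`-th power of the sum
of one factor. -/
theorem hasSum_prod_fin {f : ℤ → ℝ} {S : ℝ} (hf0 : ∀ n, 0 ≤ f n) (hf : HasSum f S) (d : ℕ) :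
    HasSum (fun β : Fin d → ℤ => ∏ j, f (β j)) (S ^ d) := by
  induction d with
  | zero => simp
  | succ d ih =>
    have hsumm : Summable fun x : ℤ × (Fin d → ℤ) => f x.1 * ∏ j, f (x.2 j) :=
      Summable.mul_of_nonneg (f := f) (g := fun β : Fin d → ℤ => ∏ j, f (β j))
        hf.summable ih.summable hf0 (fun β => Finset.prod_nonneg fun j _ => hf0 (β j))
    have h := hf.mul ih hsumm
    have hcomp : (fun β : Fin (d + 1) → ℤ => ∏ j, f (β j)) ∘
        Fin.consEquiv (fun _ : Fin (d + 1) => ℤ) =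
        fun x : ℤ × (Fin d → ℤ) => f x.1 * ∏ j, f (x.2 j) := by
      funext x
      simp [Fin.consEquiv, Fin.prod_univ_succ]
    rw [← (Fin.consEquiv (fun _ : Fin (d + 1) => ℤ)).hasSum_iff, pow_succ', hcomp]
    exact h

theorem hasSum_pow_natAbs {q : ℝ} (hq0 : 0 ≤ q) (hq1 : q < 1) :
    HasSum (fun n : ℤ => q ^ n.natAbs) ((1 + q) / (1 - q)) := by
  have h1 : HasSum (fun n : ℕ => q ^ (n : ℤ).natAbs) (1 - q)⁻¹ := by
    simpa using hasSum_geometric_of_lt_one hq0 hq1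
  have h2 : HasSum (fun n : ℕ => q ^ (-((n : ℤ) + 1)).natAbs) ((1 - q)⁻¹ * q) := by
    have h := (hasSum_geometric_of_lt_one hq0 hq1).mul_right q
    have hpow : ∀ n : ℕ, q ^ n * q = q ^ (-((n : ℤ) + 1)).natAbs := fun n => by
      rw [← pow_succ]
      congr 1
    simpa only [hpow] using h
  have hval : (1 + q) / (1 - q) = (1 - q)⁻¹ + (1 - q)⁻¹ * q := by
    rw [div_eq_mul_inv]
    ring
  rw [hval]
  exact HasSum.of_nat_of_neg_add_one h1 h2

theorem sum_abs_le_sqrt_card_mul_sqrt (d : ℕ) (x : Fin d → ℝ) :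
    ∑ j, |x j| ≤ √d * √(∑ j, x j ^ 2) := by
  rw [← Real.sqrt_mul (Nat.cast_nonneg d)]
  apply Real.le_sqrt_of_sq_le
  simpa using sq_sum_le_card_mul_sum_sq (s := Finset.univ) (f := fun j => |x j|)

theorem sqrt_three_gt : (1.732 : ℝ) < √3 := by
  rw [Real.lt_sqrt (by norm_num)]
  norm_num

theorem one_le_log_two_add_sqrt_three : 1 ≤ Real.log (2 + √3) := by
  rw [Real.le_log_iff_exp_le (by positivity)]
  linarith [Real.exp_one_lt_d9, sqrt_three_gt]

/-- A power inequality `c⁻ᵐ ≤ (2 + √3)ᵏ` bounds `(2 + √3)⁻ˢ` by `c` as soon as `k ≤ m s`. -/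
theorem exp_neg_mul_log_le {s c : ℝ} (hc : 0 < c) {k m : ℕ} (hm : 0 < m)
    (hs : (k : ℝ) ≤ m * s) (h : (c⁻¹) ^ m ≤ (3.732 : ℝ) ^ k) :
    Real.exp (-(s * Real.log (2 + √3))) ≤ c := by
  rw [← Real.le_log_iff_exp_le hc]
  have hL := one_le_log_two_add_sqrt_three
  have h' : (c⁻¹) ^ m ≤ (2 + √3) ^ k :=
    h.trans (pow_le_pow_left₀ (by norm_num) (by linarith [sqrt_three_gt]) k)
  have h2 := Real.log_le_log (by positivity) h'
  rw [Real.log_pow, Real.log_pow, Real.log_inv] at h2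
  have h3 := mul_le_mul_of_nonneg_right hs (zero_le_one.trans hL)
  have hm' : (0 : ℝ) < m := by exact_mod_cast hm
  refine le_of_mul_le_mul_left ?_ hm'
  nlinarith

theorem one_add_div_one_sub_le {q c : ℝ} (hqc : q ≤ c) (hc : c < 1) :
    (1 + q) / (1 - q) ≤ (1 + c) / (1 - c) := by
  rw [div_le_div_iff₀ (by linarith) (by linarith)]
  nlinarith

theorem inv_two_add_sqrt_three_pow_le (d k : ℕ) (h : k ≤ d) :
    ((2 + √3) ^ d)⁻¹ ≤ ((3.732 : ℝ) ^ k)⁻¹ := by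
  have := sqrt_three_gt
  apply inv_anti₀ (by positivity)
  exact (pow_le_pow_left₀ (by norm_num) (by linarith) k).trans
    (pow_le_pow_right₀ (by linarith) h)

theorem one_add_div_one_sub_pow_le_of_four_le (d : ℕ) (hd : 4 ≤ d) {q : ℝ}
    (hq : q = Real.exp (-(√d * Real.log (2 + √3)))) :
    ((1 + q) / (1 - q)) ^ d ≤ 2 - ((2 + √3) ^ d)⁻¹ := by
  have hL := one_le_log_two_add_sqrt_three
  have hd' : (4 : ℝ) ≤ d := by exact_mod_cast hd
  have hs : 2 ≤ √(d : ℝ) := by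
    apply Real.le_sqrt_of_sq_le
    linarith
  have hss : √(d : ℝ) ^ 2 = d := Real.sq_sqrt (by positivity)
  have hq0 : 0 < q := hq ▸ Real.exp_pos _
  have hqs : q ≤ 0.0719 := by
    rw [hq]
    exact exp_neg_mul_log_le (k := 2) (m := 1) (by norm_num) one_pos (by simpa using hs)
      (by norm_num)
  have h2 : Real.exp (-(2 * Real.log (2 + √3))) ≤ 0.0719 :=
    exp_neg_mul_log_le (k := 2) (m := 1) (by norm_num) one_pos (by simp) (by norm_num)
  have hdq : d * q ≤ 0.2876 := by
    have e1 : √(d : ℝ) / 2 ≤ Real.exp (√d / 2 - 1) := by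
      linarith [Real.add_one_le_exp (√(d : ℝ) / 2 - 1)]
    have e2 : (d : ℝ) ≤ 4 * Real.exp ((√d - 2) * Real.log (2 + √3)) := by
      have e3 := pow_le_pow_left₀ (by positivity) e1 2
      rw [← Real.exp_nat_mul] at e3
      have e4 : Real.exp ((2 : ℕ) * (√d / 2 - 1)) ≤
          Real.exp ((√d - 2) * Real.log (2 + √3)) := by
        apply Real.exp_le_exp.mpr
        push_cast
        nlinarith
      nlinarith
    calc d * q ≤ 4 * Real.exp ((√d - 2) * Real.log (2 + √3)) * q := by gcongr
      _ = 4 * Real.exp (-(2 * Real.log (2 + √3))) := by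
        rw [hq, mul_assoc, ← Real.exp_add]
        ring_nf
      _ ≤ 0.2876 := by linarith
  have h3 : (1 + q) / (1 - q) ≤ Real.exp (2 * q / (1 - q)) := by
    have e : (1 + q) / (1 - q) = 2 * q / (1 - q) + 1 := by
      have : 1 - q ≠ 0 := by linarith
      field_simp
      ring
    rw [e]
    exact Real.add_one_le_exp _
  have h4 : Real.exp (5 / 8) ≤ 1.9 := by
    refine le_of_pow_le_pow_left₀ (n := 8) (by norm_num) (by norm_num) ?_
    have e : Real.exp (5 / 8) ^ 8 = Real.exp 1 ^ 5 := by
      rw [← Real.exp_nat_mul, ← Real.exp_nat_mul]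
      norm_num
    rw [e]
    exact (pow_le_pow_left₀ (Real.exp_pos 1).le Real.exp_one_lt_d9.le 5).trans (by norm_num)
  have h5 : ((1 + q) / (1 - q)) ^ d ≤ Real.exp (5 / 8) := by
    have hpos : 0 ≤ (1 + q) / (1 - q) := div_nonneg (by linarith) (by linarith)
    refine (pow_le_pow_left₀ hpos h3 d).trans ?_
    rw [← Real.exp_nat_mul]
    apply Real.exp_le_exp.mpr
    rw [← mul_div_assoc, div_le_iff₀ (by linarith)]
    linarith
  have h6 := inv_two_add_sqrt_three_pow_le d 2 (by omega)
  norm_num at h4 h5 h6 ⊢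
  linarith

theorem one_add_div_one_sub_pow_le (d : ℕ) (hd : 1 ≤ d) {q : ℝ}
    (hq : q = Real.exp (-(√d * Real.log (2 + √3)))) :
    ((1 + q) / (1 - q)) ^ d ≤ 2 - ((2 + √3) ^ d)⁻¹ := by
  have hq0 : 0 < q := hq ▸ Real.exp_pos _
  have hle : ∀ c : ℝ, q ≤ c → c < 1 →
      ((1 + q) / (1 - q)) ^ d ≤ ((1 + c) / (1 - c)) ^ d := fun c hqc hc =>
    pow_le_pow_left₀ (div_nonneg (by linarith) (by linarith)) (one_add_div_one_sub_le hqc hc) d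
  obtain rfl | rfl | rfl | h4 : d = 1 ∨ d = 2 ∨ d = 3 ∨ 4 ≤ d := by omega
  · have h3 : √(3 : ℝ) ^ 2 = 3 := Real.sq_sqrt (by norm_num)
    have hq' : q = 2 - √3 := by
      rw [hq, Nat.cast_one, Real.sqrt_one, one_mul, Real.exp_neg, Real.exp_log (by positivity)]
      apply inv_eq_of_mul_eq_one_right
      linarith
    have hinv : (2 + √(3 : ℝ))⁻¹ = 2 - √3 := inv_eq_of_mul_eq_one_right (by linarith)
    rw [pow_one, pow_one, hinv, hq', div_le_iff₀ (by linarith [sqrt_three_gt])]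
    linarith
  · have hs : (1.4 : ℝ) ≤ √(2 : ℕ) := Real.le_sqrt_of_sq_le (by norm_num)
    have hqc : q ≤ 0.16 := by
      rw [hq]
      exact exp_neg_mul_log_le (k := 7) (m := 5) (by norm_num) (by norm_num)
        (by push_cast at hs ⊢; linarith) (by norm_num)
    have h6 := inv_two_add_sqrt_three_pow_le 2 2 le_rfl
    have h7 := hle _ hqc (by norm_num)
    norm_num at h6 h7 ⊢
    linarith
  · have hs : (1.7 : ℝ) ≤ √(3 : ℕ) := Real.le_sqrt_of_sq_le (by norm_num)
    have hqc : q ≤ 0.11 := by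
      rw [hq]
      exact exp_neg_mul_log_le (k := 17) (m := 10) (by norm_num) (by norm_num)
        (by push_cast at hs ⊢; linarith) (by norm_num)
    have h6 := inv_two_add_sqrt_three_pow_le 3 3 le_rfl
    have h7 := hle _ hqc (by norm_num)
    norm_num at h6 h7 ⊢
    linarith
  · exact one_add_div_one_sub_pow_le_of_four_le d h4 hq

theorem exp_neg_mul_norm_le_prod (d : ℕ) {δ : ℝ} (hδ : (d : ℝ) * Real.log (2 + √3) ≤ δ)
    (β : Fin d → ℤ) :
    Real.exp (-δ * √(∑ j, (β j : ℝ) ^ 2)) ≤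
      ∏ j, Real.exp (-(√d * Real.log (2 + √3))) ^ (β j).natAbs := by
  have hL := one_le_log_two_add_sqrt_three
  have hcs := sum_abs_le_sqrt_card_mul_sqrt d (fun j => (β j : ℝ))
  have e : ∏ j, Real.exp (-(√d * Real.log (2 + √3))) ^ (β j).natAbs =
      Real.exp (-(√d * Real.log (2 + √3)) * ∑ j, |(β j : ℝ)|) := by
    rw [Finset.mul_sum, Real.exp_sum]
    refine Finset.prod_congr rfl fun j _ => ?_
    rw [← Real.exp_nat_mul, Nat.cast_natAbs, Int.cast_abs, mul_comm]
  rw [e]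
  apply Real.exp_le_exp.mpr
  have h1 := mul_le_mul_of_nonneg_right hδ (Real.sqrt_nonneg (∑ j, (β j : ℝ) ^ 2))
  have h2 := mul_le_mul_of_nonneg_left hcs
    (mul_nonneg (Real.sqrt_nonneg (d : ℝ)) (zero_le_one.trans hL))
  have h3 : √(d : ℝ) * Real.log (2 + √3) * (√d * √(∑ j, (β j : ℝ) ^ 2)) =
      d * Real.log (2 + √3) * √(∑ j, (β j : ℝ) ^ 2) := by
    linear_combination (Real.log (2 + √3) * √(∑ j, (β j : ℝ) ^ 2)) *
      Real.mul_self_sqrt (Nat.cast_nonneg (α := ℝ) d)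
  linarith

/-- For `d ≥ 1` and `δ ≥ d·log(2+√3)`, the sum over nonzero lattice points `β ∈ ℤᵈ` of
`e^{−δ‖β‖}` (Euclidean norm) is at most `1 − (2+√3)^{−d}`; in particular it is `< 1`. -/
theorem lattice_sum_bound (d : ℕ) (hd : 1 ≤ d) (δ : ℝ)
    (hδ : (d : ℝ) * Real.log (2 + Real.sqrt 3) ≤ δ) :
    (∑' β : {b : Fin d → ℤ // b ≠ 0},
        Real.exp (-δ * Real.sqrt (∑ j, ((β.1 j : ℝ)) ^ 2))) ≤
      1 - ((2 + Real.sqrt 3) ^ d)⁻¹ ∧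
    (∑' β : {b : Fin d → ℤ // b ≠ 0},
        Real.exp (-δ * Real.sqrt (∑ j, ((β.1 j : ℝ)) ^ 2))) < 1 := by
  have hL := one_le_log_two_add_sqrt_three
  have hpos : 0 < ((2 + √3) ^ d)⁻¹ := by positivity
  suffices h : (∑' β : {b : Fin d → ℤ // b ≠ 0},
      Real.exp (-δ * √(∑ j, (β.1 j : ℝ) ^ 2))) ≤ 1 - ((2 + √3) ^ d)⁻¹ from
    ⟨h, by linarith⟩
  obtain ⟨q, hq⟩ : ∃ q, q = Real.exp (-(√d * Real.log (2 + √3))) := ⟨_, rfl⟩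
  have hq0 : 0 < q := hq ▸ Real.exp_pos _
  have hq1 : q < 1 := by
    have : 0 < √(d : ℝ) := Real.sqrt_pos.mpr (by exact_mod_cast hd)
    rw [hq, Real.exp_lt_one_iff]
    nlinarith
  have hsum := hasSum_prod_fin (fun n : ℤ => pow_nonneg hq0.le n.natAbs)
    (hasSum_pow_natAbs hq0.le hq1) d
  have hle : ∀ β : Fin d → ℤ, Real.exp (-δ * √(∑ j, (β j : ℝ) ^ 2)) ≤
      ∏ j, q ^ (β j).natAbs := fun β => hq ▸ exp_neg_mul_norm_le_prod d hδ β
  have hsumm : Summable fun β : Fin d → ℤ => Real.exp (-δ * √(∑ j, (β j : ℝ) ^ 2)) :=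
    hsum.summable.of_nonneg_of_le (fun _ => (Real.exp_pos _).le) hle
  have hsplit := hsumm.sum_add_tsum_subtype_compl {0}
  have htotal := (hsumm.tsum_le_tsum hle hsum.summable).trans_eq hsum.tsum_eq
  have hpow := one_add_div_one_sub_pow_le d hd hq
  have hcompl := (Equiv.subtypeEquivRight (p := fun b : Fin d → ℤ => b ≠ 0)
    (q := fun b => b ∉ ({0} : Finset (Fin d → ℤ))) (fun b => by simp)).tsum_eq
    (fun β => Real.exp (-δ * √(∑ j, (β.1 j : ℝ) ^ 2)))
  simp only [Equiv.subtypeEquivRight_apply_coe] at hcompl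
  rw [hcompl]
  simp only [Finset.sum_singleton, Pi.zero_apply, Int.cast_zero, ne_eq,
    OfNat.ofNat_ne_zero, not_false_eq_true, zero_pow, Finset.sum_const_zero, Real.sqrt_zero,
    mul_zero, Real.exp_zero] at hsplit
  linarith
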